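/- Let n ∈ ℕ and let f ∈ ℝ[x₁,…,xₙ] be nonnegative on ℝⁿ with deg f = 2d for some d ∈ ℕ. Then there exists a constant c > 0 such that for every x ∈ ℝⁿ, lim_{t→∞} 𝔭_f(x,t)·t^{−d} = c; namely c = Δ^d f / d!, which is a positive constant. -/

import Mathlib

open MvPolynomial Finset Filter

/-- The Laplace operator `Δ = ∂₁² + ⋯ + ∂ₙ²` on polynomials. -/
noncomputable def lap {n : ℕ} (p : MvPolynomial (Fin n) ℝ) : MvPolynomial (Fin n) ℝ :=
  ∑ i, MvPolynomial.pderiv i (MvPolynomial.pderiv i p)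

/-- The heat evolution of a polynomial: `𝔭_f(·,t) = Σ_k t^k Δ^k f / k!` (a finite sum,
since `Δ^k f = 0` for `2k > deg f`). -/
noncomputable def heatEvol {n : ℕ} (f : MvPolynomial (Fin n) ℝ) (t : ℝ) :
    MvPolynomial (Fin n) ℝ :=
  ∑ k ∈ Finset.range (f.totalDegree + 1), (t ^ k / (k.factorial : ℝ)) • (lap^[k] f)

open MeasureTheory ProbabilityTheory

section GaussianMoments

lemma integrable_pow_gaussianReal (k : ℕ) :
    Integrable (fun x : ℝ => x ^ k) (gaussianReal 0 1) := by
  refine (memLp_id_gaussianReal (μ := 0) (v := 1) (k : NNReal)).integrable_norm_pow'.mono'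
    (by fun_prop) (ae_of_all _ fun x => ?_)
  simp

lemma integrable_pow_mul_gaussianPDFReal (k : ℕ) :
    Integrable (fun x : ℝ => x ^ k * gaussianPDFReal 0 1 x) := by
  have h := integrable_pow_gaussianReal k
  rw [gaussianReal_of_var_ne_zero 0 one_ne_zero, integrable_withDensity_iff_integrable_smul'
    (measurable_gaussianPDF 0 1) (ae_of_all _ fun _ => gaussianPDF_lt_top)] at h
  simpa [mul_comm] using h

lemma hasDerivAt_gaussianPDFReal (x : ℝ) :
    HasDerivAt (gaussianPDFReal 0 1) (-(x * gaussianPDFReal 0 1 x)) x := by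
  have h : HasDerivAt (fun y : ℝ => -(y - 0) ^ 2 / (2 * ((1 : NNReal) : ℝ))) (-x) x := by
    refine ((((hasDerivAt_id' x).sub_const 0).fun_pow 2).fun_neg.div_const
      (2 * ((1 : NNReal) : ℝ))).congr_deriv ?_
    norm_num
    ring
  rw [gaussianPDFReal_def]
  refine (h.exp.const_mul (Real.sqrt (2 * Real.pi * ((1 : NNReal) : ℝ)))⁻¹).congr_deriv ?_
  ring

/-- The moment recursion of the standard Gaussian. -/
lemma integral_pow_succ_gaussianReal (k : ℕ) :
    ∫ x, x ^ (k + 1) ∂gaussianReal 0 1 = k * ∫ x, x ^ (k - 1) ∂gaussianReal 0 1 := by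
  have h := integral_mul_deriv_eq_deriv_mul_of_integrable
    (u := fun x : ℝ => x ^ k) (v := gaussianPDFReal 0 1)
    (u' := fun x => k * x ^ (k - 1)) (v' := fun x => -(x * gaussianPDFReal 0 1 x))
    (fun x _ => hasDerivAt_pow k x) (fun x _ => hasDerivAt_gaussianPDFReal x)
    (by
      convert (integrable_pow_mul_gaussianPDFReal (k + 1)).neg using 1
      ext x
      simp only [Pi.mul_apply, Pi.neg_apply]
      ring)
    (by
      convert (integrable_pow_mul_gaussianPDFReal (k - 1)).const_mul (k : ℝ) using 1
      ext x
      simp only [Pi.mul_apply]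
      ring)
    (integrable_pow_mul_gaussianPDFReal k)
  rw [integral_gaussianReal_eq_integral_smul one_ne_zero,
    integral_gaussianReal_eq_integral_smul one_ne_zero, ← integral_const_mul, ← neg_inj,
    ← integral_neg]
  refine (integral_congr_ae (ae_of_all _ fun x => ?_)).trans
    (h.trans (congrArg Neg.neg (integral_congr_ae (ae_of_all _ fun x => ?_))))
  · simp only [smul_eq_mul]
    ring
  · simp only [smul_eq_mul]
    ring

end GaussianMoments

section StandardGaussian

variable {n : ℕ}

/-- The standard Gaussian measure on `ℝⁿ`. -/
noncomputable def stdGauss (n : ℕ) : Measure (Fin n → ℝ) :=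
  Measure.pi fun _ => gaussianReal 0 1

instance isOpenPosMeasure_stdGauss : (stdGauss n).IsOpenPosMeasure := by
  have : (gaussianReal 0 1).IsOpenPosMeasure :=
    (gaussianReal_absolutelyContinuous' 0 one_ne_zero).isOpenPosMeasure
  exact Measure.pi.isOpenPosMeasure _

instance isProbabilityMeasure_stdGauss : IsProbabilityMeasure (stdGauss n) := by
  unfold stdGauss
  infer_instance

lemma eval_monomial_eq_prod (s : Fin n →₀ ℕ) (a : ℝ) (x : Fin n → ℝ) :
    eval x (monomial s a) = a * ∏ i, x i ^ s i := by
  rw [eval_monomial, Finsupp.prod_fintype _ _ fun i => pow_zero _]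

lemma integrable_eval_stdGauss (p : MvPolynomial (Fin n) ℝ) :
    Integrable (fun x => eval x p) (stdGauss n) := by
  induction p using MvPolynomial.induction_on' with
  | monomial s a =>
    simp only [eval_monomial_eq_prod]
    exact (Integrable.fintype_prod (f := fun i (y : ℝ) => y ^ s i)
      fun i => integrable_pow_gaussianReal (s i)).const_mul a
  | add p q hp hq =>
    simp only [map_add]
    exact hp.add hq

/-- The expectation of a polynomial in independent standard Gaussian variables. -/
noncomputable def gaussExp (n : ℕ) : MvPolynomial (Fin n) ℝ →ₗ[ℝ] ℝ where
  toFun p := ∫ x, eval x p ∂stdGauss n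
  map_add' p q := by
    simp only [map_add]
    exact integral_add (integrable_eval_stdGauss p) (integrable_eval_stdGauss q)
  map_smul' a p := by
    simp only [smul_eval, integral_const_mul, RingHom.id_apply, smul_eq_mul]

lemma gaussExp_apply (p : MvPolynomial (Fin n) ℝ) :
    gaussExp n p = ∫ x, eval x p ∂stdGauss n := rfl

lemma gaussExp_C (a : ℝ) : gaussExp n (C a) = a := by
  simp [gaussExp_apply]

lemma gaussExp_monomial (s : Fin n →₀ ℕ) (a : ℝ) :
    gaussExp n (monomial s a) = a * ∏ i, ∫ y, y ^ s i ∂gaussianReal 0 1 := by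
  simp only [gaussExp_apply, eval_monomial_eq_prod, integral_const_mul, stdGauss]
  rw [integral_fintype_prod_eq_prod (fun i (y : ℝ) => y ^ s i)]

/-- Gaussian integration by parts. -/
lemma gaussExp_X_mul (i : Fin n) (p : MvPolynomial (Fin n) ℝ) :
    gaussExp n (X i * p) = gaussExp n (pderiv i p) := by
  induction p using MvPolynomial.induction_on' with
  | monomial s a =>
    rw [X, monomial_mul, one_mul, pderiv_monomial, gaussExp_monomial, gaussExp_monomial,
      ← Finset.mul_prod_erase _ _ (Finset.mem_univ i),
      ← Finset.mul_prod_erase _ _ (Finset.mem_univ i)]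
    have hadd : ∏ j ∈ Finset.univ.erase i,
          ∫ y, y ^ (Finsupp.single i 1 + s : Fin n →₀ ℕ) j ∂gaussianReal 0 1
        = ∏ j ∈ Finset.univ.erase i, ∫ y, y ^ s j ∂gaussianReal 0 1 :=
      Finset.prod_congr rfl fun j hj => by
        simp [Finsupp.single_eq_of_ne (Finset.ne_of_mem_erase hj)]
    have hsub : ∏ j ∈ Finset.univ.erase i,
          ∫ y, y ^ (s - Finsupp.single i 1 : Fin n →₀ ℕ) j ∂gaussianReal 0 1
        = ∏ j ∈ Finset.univ.erase i, ∫ y, y ^ s j ∂gaussianReal 0 1 :=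
      Finset.prod_congr rfl fun j hj => by
        simp [Finsupp.single_eq_of_ne (Finset.ne_of_mem_erase hj)]
    have hadd_self : (Finsupp.single i 1 + s : Fin n →₀ ℕ) i = s i + 1 := by simp [add_comm]
    have hsub_self : (s - Finsupp.single i 1 : Fin n →₀ ℕ) i = s i - 1 := by simp
    rw [hadd, hsub, hadd_self, hsub_self, integral_pow_succ_gaussianReal]
    ring
  | add p q hp hq => simp only [mul_add, map_add, hp, hq]

lemma gaussExp_pos {p : MvPolynomial (Fin n) ℝ} (hp : ∀ x, 0 ≤ eval x p) (h0 : p ≠ 0) :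
    0 < gaussExp n p := by
  obtain ⟨x, hx⟩ : ∃ x, eval x p ≠ 0 := by
    by_contra! h
    exact h0 (MvPolynomial.funext fun x => by simpa using h x)
  exact integral_pos_of_integrable_nonneg_nonzero (MvPolynomial.continuous_eval p)
    (integrable_eval_stdGauss p) hp hx

end StandardGaussian

section Laplacian

variable {n : ℕ}

/-- The Laplace operator as a linear map. -/
noncomputable def lapLinearMap (n : ℕ) : Module.End ℝ (MvPolynomial (Fin n) ℝ) where
  toFun := lap
  map_add' p q := by simp [lap, Finset.sum_add_distrib]
  map_smul' a p := by simp [lap, Finset.smul_sum]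

lemma lap_iterate_eq (k : ℕ) (p : MvPolynomial (Fin n) ℝ) :
    lap^[k] p = (lapLinearMap n ^ k) p :=
  (Module.End.pow_apply (lapLinearMap n) k p).symm

lemma lap_iterate_zero (k : ℕ) : lap^[k] (0 : MvPolynomial (Fin n) ℝ) = 0 := by
  rw [lap_iterate_eq, map_zero]

lemma isHomogeneous_lap {p : MvPolynomial (Fin n) ℝ} {m : ℕ} (hp : p.IsHomogeneous m) :
    (lap p).IsHomogeneous (m - 2) :=
  IsHomogeneous.sum _ _ _ fun _ _ => hp.pderiv.pderiv

lemma lap_eq_zero_of_isHomogeneous {p : MvPolynomial (Fin n) ℝ} {m : ℕ}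
    (hp : p.IsHomogeneous m) (hm : m < 2) : lap p = 0 := by
  refine Finset.sum_eq_zero fun i _ => ?_
  have h : (pderiv i p).IsHomogeneous 0 := by
    have := hp.pderiv (i := i)
    rwa [show m - 1 = 0 by omega] at this
  rw [← totalDegree_zero_iff_isHomogeneous, totalDegree_eq_zero_iff_eq_C] at h
  rw [h, pderiv_C]

lemma isHomogeneous_lap_iterate (k : ℕ) {p : MvPolynomial (Fin n) ℝ} {m : ℕ}
    (hp : p.IsHomogeneous m) : (lap^[k] p).IsHomogeneous (m - 2 * k) := by
  induction k generalizing p m with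
  | zero => simpa using hp
  | succ k ih =>
    rw [Function.iterate_succ_apply, show m - 2 * (k + 1) = m - 2 - 2 * k by omega]
    exact ih (isHomogeneous_lap hp)

lemma lap_iterate_eq_zero_of_isHomogeneous (k : ℕ) {p : MvPolynomial (Fin n) ℝ} {m : ℕ}
    (hp : p.IsHomogeneous m) (hm : m < 2 * k) : lap^[k] p = 0 := by
  induction k generalizing p m with
  | zero => omega
  | succ k ih =>
    rw [Function.iterate_succ_apply]
    rcases lt_or_ge m 2 with h | h
    · rw [lap_eq_zero_of_isHomogeneous hp h, lap_iterate_zero]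
    · exact ih (isHomogeneous_lap hp) (by omega)

lemma lap_iterate_eq_zero_of_totalDegree_lt (k : ℕ) {f : MvPolynomial (Fin n) ℝ}
    (hf : f.totalDegree < 2 * k) : lap^[k] f = 0 := by
  rw [← sum_homogeneousComponent f, lap_iterate_eq, map_sum]
  refine Finset.sum_eq_zero fun i hi => ?_
  rw [← lap_iterate_eq]
  exact lap_iterate_eq_zero_of_isHomogeneous k (homogeneousComponent_isHomogeneous i f)
    (by rw [Finset.mem_range] at hi; omega)

lemma lap_iterate_eq_lap_iterate_homogeneousComponent (d : ℕ) {f : MvPolynomial (Fin n) ℝ}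
    (hf : f.totalDegree = 2 * d) : lap^[d] f = lap^[d] (homogeneousComponent (2 * d) f) := by
  conv_lhs => rw [← sum_homogeneousComponent f, lap_iterate_eq, map_sum, hf]
  rw [Finset.sum_range_succ, Finset.sum_eq_zero, zero_add, ← lap_iterate_eq]
  intro i hi
  rw [← lap_iterate_eq]
  exact lap_iterate_eq_zero_of_isHomogeneous d (homogeneousComponent_isHomogeneous i f)
    (Finset.mem_range.1 hi)

/-- Euler's identity combined with Gaussian integration by parts. -/
lemma gaussExp_lap {p : MvPolynomial (Fin n) ℝ} {m : ℕ} (hp : p.IsHomogeneous m) :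
    gaussExp n (lap p) = m * gaussExp n p := by
  rw [← nsmul_eq_mul, ← map_nsmul, ← hp.sum_X_mul_pderiv, lap, map_sum, map_sum]
  exact Finset.sum_congr rfl fun i _ => (gaussExp_X_mul i _).symm

lemma gaussExp_lap_iterate_pos (d : ℕ) {p : MvPolynomial (Fin n) ℝ}
    (hp : p.IsHomogeneous (2 * d)) (hpos : 0 < gaussExp n p) : 0 < gaussExp n (lap^[d] p) := by
  induction d generalizing p with
  | zero => exact hpos
  | succ d ih =>
    rw [Function.iterate_succ_apply]
    refine ih (isHomogeneous_lap hp) ?_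
    rw [gaussExp_lap hp]
    positivity

end Laplacian

section LeadingBehaviour

lemma tendsto_sum_mul_pow_div_pow (N m : ℕ) (hm : m < N) (a : ℕ → ℝ)
    (ha : ∀ k, m < k → a k = 0) :
    Tendsto (fun t : ℝ => (∑ k ∈ Finset.range N, t ^ k * a k) / t ^ m) atTop (nhds (a m)) := by
  have h : ∀ k ∈ Finset.range N,
      Tendsto (fun t : ℝ => t ^ k * a k / t ^ m) atTop (nhds (if k = m then a m else 0)) := by
    intro k _
    rcases lt_trichotomy k m with hk | rfl | hk
    · rw [if_neg hk.ne]
      simpa [mul_div_right_comm] using (tendsto_pow_div_pow_atTop_zero hk).mul_const (a k)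
    · rw [if_pos rfl]
      refine tendsto_const_nhds.congr' ?_
      filter_upwards [eventually_gt_atTop 0] with t ht
      field_simp
    · simp [ha k hk, hk.ne']
  simp only [Finset.sum_div]
  convert tendsto_finsetSum _ h using 2
  rw [Finset.sum_ite_eq' (Finset.range N) m, if_pos (Finset.mem_range.2 hm)]

variable {n : ℕ}

lemma eval_smul_of_isHomogeneous {p : MvPolynomial (Fin n) ℝ} {m : ℕ} (hp : p.IsHomogeneous m)
    (t : ℝ) (x : Fin n → ℝ) : eval (t • x) p = t ^ m * eval x p := by
  rw [eval_eq', eval_eq', Finset.mul_sum]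
  refine Finset.sum_congr rfl fun s hs => ?_
  have h : m = ∑ i, s i := by
    rw [hp.degree_eq_sum_deg_support hs]
    exact Finset.sum_subset (Finset.subset_univ _) fun i _ hi => Finsupp.notMem_support_iff.1 hi
  simp only [Pi.smul_apply, smul_eq_mul, mul_pow, Finset.prod_mul_distrib,
    Finset.prod_pow_eq_pow_sum, ← h]
  ring

/-- The leading form of a nonnegative polynomial is nonnegative. -/
lemma eval_homogeneousComponent_totalDegree_nonneg {f : MvPolynomial (Fin n) ℝ}
    (hf : ∀ x, 0 ≤ eval x f) (x : Fin n → ℝ) :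
    0 ≤ eval x (homogeneousComponent f.totalDegree f) := by
  refine ge_of_tendsto (tendsto_sum_mul_pow_div_pow (f.totalDegree + 1) f.totalDegree
    (Nat.lt_succ_self _) (fun k => eval x (homogeneousComponent k f))
    fun k hk => by rw [homogeneousComponent_eq_zero k f hk, map_zero]) ?_
  filter_upwards [eventually_gt_atTop 0] with t ht
  have h : ∑ k ∈ Finset.range (f.totalDegree + 1), t ^ k * eval x (homogeneousComponent k f)
      = eval (t • x) f := by
    conv_rhs => rw [← sum_homogeneousComponent f, map_sum]
    exact Finset.sum_congr rfl fun k _ =>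
      (eval_smul_of_isHomogeneous (homogeneousComponent_isHomogeneous k f) t x).symm
  rw [h]
  exact div_nonneg (hf _) (by positivity)

lemma homogeneousComponent_totalDegree_ne_zero {f : MvPolynomial (Fin n) ℝ} (hf : f ≠ 0) :
    homogeneousComponent f.totalDegree f ≠ 0 := by
  obtain ⟨s, hs, hdeg⟩ := Finset.exists_mem_eq_sup f.support (support_nonempty.2 hf)
    fun s => s.sum fun _ e => e
  intro h
  have hc := congrArg (coeff s) h
  rw [coeff_homogeneousComponent, if_pos, coeff_zero] at hc
  · exact mem_support_iff.1 hs hc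
  · rw [totalDegree, hdeg]
    rfl

end LeadingBehaviour

/-- For a nonnegative polynomial `f` of degree `2d`, `𝔭_f(x,t)·t^{−d} → c > 0` as
`t → ∞`, where `c = Δ^d f / d!` is a positive constant. -/
theorem heatEvol_asymptotically_constant (n : ℕ) (hn : 0 < n) (d : ℕ) (hd : 0 < d)
    (f : MvPolynomial (Fin n) ℝ) (hnonneg : ∀ x : Fin n → ℝ, 0 ≤ MvPolynomial.eval x f)
    (hdeg : f.totalDegree = 2 * d) :
    ∃ c : ℝ, 0 < c ∧ lap^[d] f = MvPolynomial.C ((d.factorial : ℝ) * c) ∧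
      ∀ x : Fin n → ℝ,
        Tendsto (fun t : ℝ => MvPolynomial.eval x (heatEvol f t) / t ^ d)
          atTop (nhds c) := by
  set g := homogeneousComponent (2 * d) f with hg
  have hhom : g.IsHomogeneous (2 * d) := homogeneousComponent_isHomogeneous _ f
  have hf0 : f ≠ 0 := by
    rintro rfl
    rw [totalDegree_zero] at hdeg
    omega
  have hpos : 0 < gaussExp n g := by
    rw [hg, ← hdeg]
    exact gaussExp_pos (eval_homogeneousComponent_totalDegree_nonneg hnonneg)
      (homogeneousComponent_totalDegree_ne_zero hf0)
  obtain ⟨b, hb⟩ : ∃ b, lap^[d] g = C b := by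
    have h := isHomogeneous_lap_iterate d hhom
    rw [Nat.sub_self, ← totalDegree_zero_iff_isHomogeneous, totalDegree_eq_zero_iff_eq_C] at h
    exact ⟨_, h⟩
  have hbpos : 0 < b := by
    have h := gaussExp_lap_iterate_pos d hhom hpos
    rwa [hb, gaussExp_C] at h
  have hlap : lap^[d] f = C b := by
    rw [lap_iterate_eq_lap_iterate_homogeneousComponent d hdeg, hb]
  refine ⟨b / d.factorial, by positivity, ?_, fun x => ?_⟩
  · rw [hlap, mul_div_cancel₀ _ (by positivity)]
  · have h := tendsto_sum_mul_pow_div_pow (f.totalDegree + 1) d (by omega)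
      (fun k => eval x (lap^[k] f) / k.factorial) fun k hk => by
        rw [lap_iterate_eq_zero_of_totalDegree_lt k (by omega), map_zero, zero_div]
    simp only [hlap, eval_C] at h
    convert h using 3 with t
    rw [heatEvol, map_sum]
    refine Finset.sum_congr rfl fun k _ => ?_
    rw [smul_eval]
    ring
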